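/- arXiv:1803.06649 — 3 statements merged into one kernel-verified Lean document; each statement's English description precedes it below -/
import Mathlib

section
/- Let Γ be the assembly with underlying set ℕ and realizers E_Γ(n) = {m ∈ ℕ | m > n}, and let A be the family of assemblies over Γ given by A(n) = {m ∈ ℕ | m > n} with realizers E_{A(n)}(m) = {n, m}. Then A has no tracked section: there is no function f : ℕ → ℕ satisfying f(n) > n for all n together with a partial recursive function e : ℕ →. ℕ such that for all natural numbers n and m with n < m, e(m) is defined and e(m) = n or e(m) = f(n). -/
/-- Let `Γ` be the assembly with underlying set `ℕ` and realizers
`E_Γ(n) = {m | m > n}`, and let `A` be the family of assemblies over `Γ` given by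
`A(n) = {m | m > n}` with realizers `E_{A(n)}(m) = {n, m}`.  A section of `A` is a
function `f : ℕ → ℕ` with `f n > n` for all `n`; it is tracked by a partial recursive
`e : ℕ →. ℕ` iff for all `n` and all realizers `m > n` of `n`, `e m` is defined and its
value realizes `f n`, i.e. `e m = n` or `e m = f n`.  There is no tracked section. -/
theorem stmt0 :
    ¬ ∃ (f : ℕ → ℕ) (e : ℕ →. ℕ), Nat.Partrec e ∧ (∀ n, n < f n) ∧
      (∀ n m : ℕ, n < m → (n ∈ e m ∨ f n ∈ e m)) := by
  rintro ⟨f, e, -, hf, he⟩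
  have hlt := hf (f 0 + 1)
  rcases he 0 (f 0 + 2) (by omega) with h | h <;>
    rcases he (f 0 + 1) (f 0 + 2) (by omega) with h' | h' <;>
    have := Part.mem_unique h h' <;> omega
end

section
/- Let A be a uniform nonempty assembly and X a modest assembly. Then the map sending x ∈ X to the constant function a ↦ x is a bijection from X onto the set of functions A → X that are tracked by some partial recursive function. -/
/-- An assembly: a set (type) together with a nonempty set of natural-number
realizers for each element. -/
structure Assembly (α : Type) where
  E : α → Set ℕ
  realizers_nonempty : ∀ a, (E a).Nonempty

/-- A function `g : α → β` between assemblies is tracked by a partial function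
`e : ℕ →. ℕ` if for every `a` and every realizer `n` of `a`, `e n` is defined and
its value realizes `g a`. -/
def Tracks {α β : Type} (A : Assembly α) (X : Assembly β) (e : ℕ →. ℕ) (g : α → β) : Prop :=
  ∀ a : α, ∀ n ∈ A.E a, ∃ m, m ∈ e n ∧ m ∈ X.E (g a)

/-- An assembly is modest if distinct elements have disjoint sets of realizers. -/
def Assembly.Modest {β : Type} (X : Assembly β) : Prop :=
  ∀ x x' : β, x ≠ x' → X.E x ∩ X.E x' = ∅

/-- An assembly is uniform if all its elements have a common realizer. -/
def Assembly.Uniform {α : Type} (A : Assembly α) : Prop :=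
  (⋂ a : α, A.E a).Nonempty

/-- For a uniform nonempty assembly `A` and a modest assembly `X`, the
map sending `x : X` to the constant function `fun _ => x` is a bijection from `X` onto
the set of functions `A → X` tracked by some partial recursive function. -/
theorem stmt3 {α β : Type} (A : Assembly α) (X : Assembly β)
    (hA : A.Uniform) (hne : Nonempty α) (hX : X.Modest) :
    Set.BijOn (fun (x : β) => (fun _ : α => x)) Set.univ
      {g : α → β | ∃ e : ℕ →. ℕ, Nat.Partrec e ∧ Tracks A X e g} := by
  obtain ⟨n, hn⟩ := hA
  rw [Set.mem_iInter] at hn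
  obtain ⟨a₀⟩ := hne
  refine ⟨fun x _ => ?_, fun x _ y _ h => congrFun h a₀, ?_⟩
  · obtain ⟨m, hm⟩ := X.realizers_nonempty x
    exact ⟨fun _ => Part.some m, Nat.Partrec.of_primrec (Nat.Primrec.const m),
      fun _ _ _ => ⟨m, Part.mem_some m, hm⟩⟩
  · rintro g ⟨e, -, he⟩
    refine ⟨g a₀, Set.mem_univ _, funext fun a => ?_⟩
    obtain ⟨m, hm, hmX⟩ := he a₀ n (hn a₀)
    obtain ⟨k, hk, hkX⟩ := he a n (hn a)
    obtain rfl := Part.mem_unique hm hk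
    by_contra hga
    exact (hX _ _ hga).subset ⟨hmX, hkX⟩
end

section
/- Let C be a small category with a terminal object 1, let I be an object of C with morphisms δ₀, δ₁ : 1 → I, and let S be a set with codiscrete presheaf ∇S. Fix e ∈ {0,1} and write ē = 1 − e. Let c be an object of C, φ a sieve on c, and f an assignment taking each morphism σ : c' → c in φ and each morphism j : c' → I to an element f(σ, j) ∈ ∇S(c'), natural in the sense that f(σ ∘ τ, j ∘ τ) = f(σ, j)·τ for every τ : c'' → c'. Let a ∈ ∇S(c) satisfy a·σ = f(σ, δ_e ∘ !_{c'}) for every σ : c' → c in φ. Then there exists ā ∈ ∇S(c) such that ā·σ = f(σ, δ_ē ∘ !_{c'}) for every σ : c' → c in φ. (That is, codiscrete presheaves admit composition of partial paths.) -/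
open CategoryTheory Limits

/-- (Codiscrete presheaves admit composition of partial paths.)
Let `C` be a small category with a terminal object, `I : C` an object with two global
points `δ₀ δ₁ : 1 ⟶ I`, and `S` a set with codiscrete presheaf `∇S(c) = (Hom(1,c) → S)`.
Fix `e : Bool` (encoding `e ∈ {0,1}`, with `!e` encoding `ē = 1 - e`), an object `c`,
a sieve `φ` on `c`, and an assignment `f` taking each `σ : c' ⟶ c` in `φ` and each
`j : c' ⟶ I` to an element `f σ _ j ∈ ∇S(c')`, natural in the sense that
`f (τ ≫ σ) (τ ≫ j) = (f σ j) · τ`.  If `a ∈ ∇S(c)` satisfies `a · σ = f σ (δ_e ∘ !)`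
for all `σ` in `φ`, then there is `ā ∈ ∇S(c)` with `ā · σ = f σ (δ_ē ∘ !)` for all `σ`
in `φ`. -/
theorem stmt10 {C : Type} [SmallCategory C] [HasTerminal C] (I : C)
    (δ₀ δ₁ : ⊤_ C ⟶ I) (S : Type) (e : Bool) (c : C) (φ : Sieve c)
    (f : ∀ ⦃c' : C⦄ (σ : c' ⟶ c), φ.arrows σ → (c' ⟶ I) → (⊤_ C ⟶ c') → S)
    (hf : ∀ ⦃c' c'' : C⦄ (σ : c' ⟶ c) (h : φ.arrows σ) (j : c' ⟶ I) (τ : c'' ⟶ c'),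
      f (τ ≫ σ) (φ.downward_closed h τ) (τ ≫ j) = fun ρ => f σ h j (ρ ≫ τ))
    (a : (⊤_ C ⟶ c) → S)
    (ha : ∀ ⦃c' : C⦄ (σ : c' ⟶ c) (h : φ.arrows σ),
      f σ h (terminal.from c' ≫ (bif e then δ₁ else δ₀)) = fun ρ => a (ρ ≫ σ)) :
    ∃ abar : (⊤_ C ⟶ c) → S,
      ∀ ⦃c' : C⦄ (σ : c' ⟶ c) (h : φ.arrows σ),
        f σ h (terminal.from c' ≫ (bif e then δ₀ else δ₁)) = fun ρ => abar (ρ ≫ σ) := by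
  classical
  set δ : ⊤_ C ⟶ I := bif e then δ₀ else δ₁
  refine ⟨fun ρ => if h : φ.arrows ρ then f ρ h (terminal.from _ ≫ δ) (𝟙 _) else a ρ, ?_⟩
  intro c' σ h
  funext ρ
  have key := congrFun (hf σ h (terminal.from c' ≫ δ) ρ) (𝟙 _)
  have hj : ρ ≫ terminal.from c' ≫ δ = terminal.from _ ≫ δ := by
    rw [← Category.assoc, Subsingleton.elim (ρ ≫ terminal.from c') (terminal.from _)]
  rw [hj, Category.id_comp] at key
  beta_reduce
  rw [dif_pos (φ.downward_closed h ρ), key]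
end
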